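/- Let t = 1260r + 169 for some integer r ≥ 1, and let n be an integer with n ≥ 540t² + (175811/2)t + 7989/2. Then there exists a simple graph G on n vertices with exactly n + 36t edges such that any two distinct cycles of G have different lengths. -/

import Mathlib

/-- A simple graph has the property that any two distinct cycles (as subgraphs,
identified with their edge sets) have different lengths. -/
def DistinctCycleLengths {V : Type*} (G : SimpleGraph V) : Prop :=
  ∀ ⦃u v : V⦄ (c₁ : G.Walk u u) (c₂ : G.Walk v v),
    c₁.IsCycle → c₂.IsCycle → c₁.length = c₂.length →
    {e | e ∈ c₁.edges} = {e | e ∈ c₂.edges}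

theorem DistinctCycleLengths.of_injective_hom {V W : Type*} {G : SimpleGraph V}
    {H : SimpleGraph W} (hH : DistinctCycleLengths H) (f : G →g H)
    (hf : Function.Injective f) : DistinctCycleLengths G := by
  intro u v c₁ c₂ h₁ h₂ hl
  have h := hH (c₁.map f) (c₂.map f) (h₁.map hf) (h₂.map hf) (by simpa using hl)
  ext e
  have he := Set.ext_iff.1 h (e.map f)
  simpa [SimpleGraph.Walk.edges_map, (Sym2.map.injective hf).eq_iff] using he

/-- The parent map of the forest whose trees, indexed by `K`, are a spine `(k, s, 0)` with a tooth
`(k, s, h)` above every spine vertex. -/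
def combParent {K : Type*} : K × ℕ × ℕ → K × ℕ × ℕ
  | (k, s, h + 1) => (k, s, h)
  | (k, s + 1, 0) => (k, s, 0)
  | (k, 0, 0) => (k, 0, 0)

/-- The comb forest together with a hub `none` joined to all vertices of `M`. -/
def hubComb {K : Type*} (M : Set (K × ℕ × ℕ)) : SimpleGraph (Option (K × ℕ × ℕ)) :=
  SimpleGraph.fromRel fun u v =>
    match u, v with
    | some u, some v => combParent u = v
    | none, some v => v ∈ M
    | _, none => False

/-- The distance between two vertices of the same tree of the comb forest. -/
def combDist {K : Type*} (a b : K × ℕ × ℕ) : ℕ :=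
  if a.2.1 = b.2.1 then (a.2.2 - b.2.2) + (b.2.2 - a.2.2)
  else a.2.2 + b.2.2 + ((a.2.1 - b.2.1) + (b.2.1 - a.2.1))

section hubComb

variable {K : Type*} {M : Set (K × ℕ × ℕ)}

theorem combDist_comm (a b : K × ℕ × ℕ) : combDist a b = combDist b a := by
  unfold combDist
  split_ifs <;> omega

theorem combParent_fst (a : K × ℕ × ℕ) : (combParent a).1 = a.1 := by
  obtain ⟨k, _ | s, _ | h⟩ := a <;> rfl

theorem combParent_rank {a : K × ℕ × ℕ} (ha : combParent a ≠ a) :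
    (combParent a).2.1 + (combParent a).2.2 + 1 = a.2.1 + a.2.2 := by
  obtain ⟨k, _ | s, _ | h⟩ := a
  · exact absurd rfl ha
  all_goals simp only [combParent] <;> omega

theorem combDist_le_succ_of_parent (a b : K × ℕ × ℕ) :
    combDist a b ≤ combDist (combParent a) b + 1 ∧
      combDist (combParent a) b ≤ combDist a b + 1 := by
  obtain ⟨k, _ | s, _ | h⟩ := a <;> obtain ⟨k', s', h'⟩ := b <;>
    simp only [combParent, combDist] <;> grind

theorem hubComb_adj_some {a b : K × ℕ × ℕ} :
    (hubComb M).Adj (some a) (some b) ↔ a ≠ b ∧ (combParent a = b ∨ combParent b = a) := by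
  simp [hubComb]

theorem hubComb_adj_none {b : K × ℕ × ℕ} : (hubComb M).Adj none (some b) ↔ b ∈ M := by
  simp [hubComb]

theorem exists_of_hubComb_adj_none {v : Option (K × ℕ × ℕ)} (h : (hubComb M).Adj none v) :
    ∃ a ∈ M, v = some a := by
  cases v with
  | none => exact absurd h ((hubComb M).loopless.irrefl _)
  | some a => exact ⟨a, hubComb_adj_none.1 h, rfl⟩

theorem none_mem_support_of_isCycle {u : Option (K × ℕ × ℕ)} {c : (hubComb M).Walk u u}
    (hc : c.IsCycle) : none ∈ c.support := by
  classical
  by_contra hn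
  let rank : Option (K × ℕ × ℕ) → ℕ := fun v => v.elim 0 fun a => a.2.1 + a.2.2
  obtain ⟨v, hv, hmax⟩ := c.support.toFinset.exists_max_image rank ⟨u, by simp⟩
  rw [List.mem_toFinset] at hv
  have key : ∀ w, (hubComb M).Adj v w → w ∈ (c.rotate v hv).support → ∃ a, v = some a ∧
      w = some (combParent a) := by
    intro w hvw hw
    rw [SimpleGraph.Walk.mem_support_rotate_iff] at hw
    have hle := hmax w (by simpa using hw)
    cases v with
    | none => exact absurd hv hn
    | some a =>
      cases w with
      | none => exact absurd hw hn
      | some b =>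
        obtain ⟨hab, h | h⟩ := hubComb_adj_some.1 hvw
        · exact ⟨a, rfl, by rw [h]⟩
        · have := combParent_rank (a := b) (by rw [h]; exact hab)
          simp only [rank, Option.elim_some] at hle
          rw [h] at this
          omega
  have hr := hc.rotate (hu := hv)
  obtain ⟨a, ha, h₁⟩ := key _ ((c.rotate v hv).adj_snd hr.not_nil)
    ((c.rotate v hv).getVert_mem_support _)
  obtain ⟨b, hb, h₂⟩ := key _ ((c.rotate v hv).adj_penultimate hr.not_nil).symm
    ((c.rotate v hv).getVert_mem_support _)
  rw [ha, Option.some_inj] at hb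
  exact hr.snd_ne_penultimate (by rw [h₁, h₂, hb])

theorem hubComb_empty_isAcyclic : (hubComb (∅ : Set (K × ℕ × ℕ))).IsAcyclic := by
  classical
  intro u c hc
  have hr := hc.rotate (hu := none_mem_support_of_isCycle hc)
  obtain ⟨a, ha, -⟩ := exists_of_hubComb_adj_none ((c.rotate none _).adj_snd hr.not_nil)
  exact ha

theorem combDist_le_length {u v : Option (K × ℕ × ℕ)}
    (w : (hubComb (∅ : Set (K × ℕ × ℕ))).Walk u v) {a b : K × ℕ × ℕ} (ha : u = some a)
    (hb : v = some b) : a.1 = b.1 ∧ combDist a b ≤ w.length := by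
  induction w generalizing a with
  | nil =>
    rw [ha, Option.some_inj] at hb
    subst hb
    simp [combDist]
  | @cons u x v h p ih =>
    subst ha
    cases x with
    | none => exact (exists_of_hubComb_adj_none h.symm).choose_spec.1.elim
    | some y =>
      obtain ⟨h₁, h₂⟩ := ih rfl hb
      rw [SimpleGraph.Walk.length_cons]
      obtain ⟨-, rfl | rfl⟩ := hubComb_adj_some.1 h
      · have := combDist_le_succ_of_parent a b
        exact ⟨by rw [← h₁, combParent_fst], by omega⟩
      · have := combDist_le_succ_of_parent y b
        exact ⟨by rw [← h₁, combParent_fst], by omega⟩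

theorem exists_tooth_walk (k : K) (s h : ℕ) :
    ∃ w : (hubComb M).Walk (some (k, s, h)) (some (k, s, 0)), w.length = h := by
  induction h with
  | zero => exact ⟨.nil, rfl⟩
  | succ h ih =>
    obtain ⟨w, hw⟩ := ih
    have hadj : (hubComb M).Adj (some (k, s, h + 1)) (some (k, s, h)) :=
      hubComb_adj_some.2 ⟨by simp, .inl rfl⟩
    exact ⟨.cons hadj w, by simp [hw]⟩

theorem exists_spine_walk (k : K) (s n : ℕ) :
    ∃ w : (hubComb M).Walk (some (k, s + n, 0)) (some (k, s, 0)), w.length = n := by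
  induction n with
  | zero => exact ⟨.nil, rfl⟩
  | succ n ih =>
    obtain ⟨w, hw⟩ := ih
    have hadj : (hubComb M).Adj (some (k, s + (n + 1), 0)) (some (k, s + n, 0)) :=
      hubComb_adj_some.2 ⟨by simp, .inl rfl⟩
    exact ⟨.cons hadj w, by simp [hw]⟩

theorem exists_walk_length_eq_combDist {a b : K × ℕ × ℕ} (hk : a.1 = b.1)
    (hs : a.2.1 ≠ b.2.1) :
    ∃ w : (hubComb M).Walk (some a) (some b), w.length = combDist a b := by
  wlog hlt : a.2.1 < b.2.1 generalizing a b
  · obtain ⟨w, hw⟩ := this hk.symm hs.symm (by omega)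
    exact ⟨w.reverse, by rw [SimpleGraph.Walk.length_reverse, hw, combDist_comm]⟩
  obtain ⟨k, s, h⟩ := a
  obtain ⟨k', s', h'⟩ := b
  obtain rfl : k = k' := hk
  obtain ⟨n, rfl⟩ : ∃ n, s' = s + n := Nat.exists_eq_add_of_le hlt.le
  obtain ⟨w₁, h₁⟩ := exists_tooth_walk (M := M) k s h
  obtain ⟨w₂, h₂⟩ := exists_spine_walk (M := M) k s n
  obtain ⟨w₃, h₃⟩ := exists_tooth_walk (M := M) k (s + n) h'
  refine ⟨(w₁.append w₂.reverse).append w₃.reverse, ?_⟩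
  simp only [SimpleGraph.Walk.length_append, SimpleGraph.Walk.length_reverse, h₁, h₂, h₃,
    combDist, if_neg hs]
  omega

theorem length_eq_combDist_of_isPath {a b : K × ℕ × ℕ} (hs : a.2.1 ≠ b.2.1)
    {p : (hubComb (∅ : Set (K × ℕ × ℕ))).Walk (some a) (some b)} (hp : p.IsPath) :
    p.length = combDist a b := by
  classical
  obtain ⟨hk, hle⟩ := combDist_le_length p rfl rfl
  obtain ⟨w, hw⟩ := exists_walk_length_eq_combDist (M := ∅) hk hs
  have h := congrArg (fun q : (hubComb (∅ : Set (K × ℕ × ℕ))).Path _ _ => q.1.length)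
    ((hubComb_empty_isAcyclic.subsingleton_path _ _).elim ⟨p, hp⟩ w.toPath)
  have := w.length_bypass_le_length
  simp only [SimpleGraph.Walk.toPath] at h
  omega

/-- The edges of the cycle that runs from the hub to `a`, inside the forest to `b`, and back. -/
def hubCycleEdges (a b : K × ℕ × ℕ) : Set (Sym2 (Option (K × ℕ × ℕ))) :=
  {e | e = s(none, some a) ∨ e = s(none, some b) ∨
    ∃ p : (hubComb (∅ : Set (K × ℕ × ℕ))).Walk (some a) (some b), p.IsPath ∧ e ∈ p.edges}

theorem hubCycleEdges_comm (a b : K × ℕ × ℕ) : hubCycleEdges a b = hubCycleEdges b a := by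
  have h : ∀ a b : K × ℕ × ℕ, hubCycleEdges a b ⊆ hubCycleEdges b a := by
    rintro a b e (he | he | ⟨p, hp, he⟩)
    · exact .inr (.inl he)
    · exact .inl he
    · exact .inr (.inr ⟨p.reverse, hp.reverse, by simpa using he⟩)
  exact (h a b).antisymm (h b a)

theorem exists_of_isCycle_hubComb
    (hM : ∀ a ∈ M, ∀ b ∈ M, a.1 = b.1 → a.2.1 = b.2.1 → a = b) {u : Option (K × ℕ × ℕ)}
    {c : (hubComb M).Walk u u} (hc : c.IsCycle) :
    ∃ a ∈ M, ∃ b ∈ M, a ≠ b ∧ a.1 = b.1 ∧ c.length = combDist a b + 2 ∧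
      {e | e ∈ c.edges} = hubCycleEdges a b := by
  classical
  wlog hu : u = none generalizing u
  · have hn := none_mem_support_of_isCycle hc
    obtain ⟨a, ha, b, hb, hab, hk, hl, he⟩ := this (hc.rotate (hu := hn)) rfl
    refine ⟨a, ha, b, hb, hab, hk, by simpa using hl, ?_⟩
    rw [← he]
    ext e
    exact (c.rotate_edges none hn).mem_iff.symm
  subst hu
  cases c with
  | nil => exact absurd rfl hc.ne_nil
  | @cons _ x _ h p =>
    obtain ⟨hp, hne⟩ := (SimpleGraph.Walk.cons_isCycle_iff p h).1 hc
    obtain ⟨q, rfl⟩ : ∃ q, p = SimpleGraph.Walk.reverse q := ⟨p.reverse, by simp⟩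
    rw [SimpleGraph.Walk.isPath_reverse_iff] at hp
    cases q with
    | nil => exact absurd h ((hubComb M).loopless.irrefl _)
    | @cons _ y _ h' q =>
      obtain ⟨hq, hnq⟩ := (SimpleGraph.Walk.cons_isPath_iff h' q).1 hp
      obtain ⟨a, ha, rfl⟩ := exists_of_hubComb_adj_none h'
      obtain ⟨b, hb, rfl⟩ := exists_of_hubComb_adj_none h
      have hab : a ≠ b := by
        rintro rfl
        simp at hne
      have hqe : ∀ e ∈ q.edges, e ∈ (hubComb (∅ : Set (K × ℕ × ℕ))).edgeSet := by
        intro e he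
        induction e with | _ v w
        have hv := q.fst_mem_support_of_mem_edges he
        have hw := q.snd_mem_support_of_mem_edges he
        have hvw := q.adj_of_mem_edges he
        cases v with
        | none => exact absurd hv hnq
        | some v =>
          cases w with
          | none => exact absurd hw hnq
          | some w =>
            exact (SimpleGraph.mem_edgeSet _).2 (hubComb_adj_some.2 (hubComb_adj_some.1 hvw))
      have hq' := hq.transfer hqe
      have hk := (combDist_le_length (q.transfer _ hqe) rfl rfl).1
      have hlen := length_eq_combDist_of_isPath (fun hs => hab (hM a ha b hb hk hs)) hq'
      rw [SimpleGraph.Walk.length_transfer] at hlen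
      refine ⟨a, ha, b, hb, hab, hk, by simp [hlen], ?_⟩
      ext e
      have hpath : (∃ p : (hubComb (∅ : Set (K × ℕ × ℕ))).Walk (some a) (some b),
          p.IsPath ∧ e ∈ p.edges) ↔ e ∈ q.edges := by
        constructor
        · rintro ⟨p, hp, he⟩
          have := (hubComb_empty_isAcyclic.subsingleton_path _ _).elim ⟨p, hp⟩ ⟨_, hq'⟩
          rw [Subtype.mk.injEq] at this
          simpa [this] using he
        · exact fun he => ⟨_, hq', by simpa using he⟩
      simp only [hubCycleEdges, hpath, Set.mem_ofPred_eq, SimpleGraph.Walk.edges_cons,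
        SimpleGraph.Walk.edges_reverse, List.mem_cons, List.mem_reverse]
      tauto

theorem distinctCycleLengths_hubComb
    (hM : ∀ a ∈ M, ∀ b ∈ M, a.1 = b.1 → a.2.1 = b.2.1 → a = b)
    (hd : ∀ a ∈ M, ∀ b ∈ M, ∀ a' ∈ M, ∀ b' ∈ M, a ≠ b → a' ≠ b' → a.1 = b.1 → a'.1 = b'.1 →
      combDist a b = combDist a' b' → s(a, b) = s(a', b')) :
    DistinctCycleLengths (hubComb M) := by
  intro u v c₁ c₂ h₁ h₂ hl
  obtain ⟨a, ha, b, hb, hab, hk, hc, he⟩ := exists_of_isCycle_hubComb hM h₁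
  obtain ⟨a', ha', b', hb', hab', hk', hc', he'⟩ := exists_of_isCycle_hubComb hM h₂
  rw [he, he']
  obtain ⟨rfl, rfl⟩ | ⟨rfl, rfl⟩ :=
    Sym2.eq_iff.1 (hd a ha b hb a' ha' b' hb' hab hab' hk hk' (by omega))
  · rfl
  · exact hubCycleEdges_comm _ _

end hubComb

/-- The tree in which the `j`-th mark of a block lies. -/
def markTree : Fin 28 → ℕ :=
  ![0, 0, 0, 0, 0, 0, 0, 1, 1, 1, 2, 2, 3, 3, 4, 4, 5, 5, 6, 6, 7, 7, 8, 8, 9, 9, 10, 10]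

/-- The position on the spine of the `j`-th mark of a block, in multiples of the scale. -/
def markPos : Fin 28 → ℕ :=
  ![0, 2, 9, 14, 20, 23, 30, 0, 4, 10, 0, 0, 0, 0, 0, 2, 0, 2, 0, 4, 0, 4, 0, 6, 0, 6, 0, 8]

/-- The correction to the position on the spine of the `j`-th mark of a block. -/
def markShift : Fin 28 → ℕ :=
  ![0, 0, 0, 0, 0, 0, 0, 0, 0, 0, 0, 2, 0, 1, 0, 2, 0, 1, 0, 2, 0, 1, 0, 2, 0, 1, 0, 2]

/-- The height of the `j`-th mark of a block, in multiples of the scale. -/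
def markHeight : Fin 28 → ℕ :=
  ![0, 6, 5, 6, 6, 5, 0, 0, 6, 0, 0, 0, 0, 0, 0, 0, 0, 0, 0, 0, 0, 0, 0, 0, 0, 0, 0, 0]

/-- The correction to the height of the `j`-th mark of a block. -/
def markBump : Fin 28 → ℕ :=
  ![0, 1, 1, 0, 1, 1, 1, 0, 0, 1, 0, 0, 0, 0, 0, 0, 0, 0, 0, 0, 0, 0, 0, 0, 0, 0, 0, 0]

/-- The position of the last mark on the spine of each of the trees of a block, in multiples of the
scale. -/
def treeLength : Fin 11 → ℕ :=
  ![30, 10, 0, 0, 2, 2, 4, 4, 6, 6, 8]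

/-- The `j`-th mark of the `i`-th of `b` blocks; the scale is `b + 1`. -/
def blockMark (b i : ℕ) (j : Fin 28) : (ℕ × ℕ) × ℕ × ℕ :=
  ((i, markTree j), markPos j * (b + 1) + markShift j, markHeight j * (b + 1) + i + markBump j)

/-- The pairs of marks in a common tree of a block. -/
def markPairs : List (Fin 28 × Fin 28) :=
  (List.finRange 28 ×ˢ List.finRange 28).filter fun p => p.1 < p.2 ∧ markTree p.1 = markTree p.2

/-- The leading term of the distance between two marks of a tree. -/
def pairSlope (p : Fin 28 × Fin 28) : ℕ :=
  markHeight p.1 + markHeight p.2 + (markPos p.2 - markPos p.1)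

/-- The correction to the distance between two marks of a tree. -/
def pairOffset (p : Fin 28 × Fin 28) : ℕ :=
  markBump p.1 + markBump p.2 + (markShift p.2 - markShift p.1)

theorem mem_markPairs {p : Fin 28 × Fin 28} :
    p ∈ markPairs ↔ p.1 < p.2 ∧ markTree p.1 = markTree p.2 := by
  obtain ⟨j, k⟩ := p
  simp [markPairs]

theorem markPairs_spec : ∀ p ∈ markPairs, markPos p.1 ≤ markPos p.2 ∧
    markShift p.1 ≤ markShift p.2 ∧
    markPos p.1 + markShift p.1 < markPos p.2 + markShift p.2 ∧
    pairSlope p % 2 = 0 ∧ pairOffset p ≤ 2 := by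
  decide +kernel

theorem nodup_pairSlots :
    (markPairs.map fun p => pairSlope p + pairOffset p % 2).Nodup := by
  decide +kernel

theorem combDist_blockMark {b i : ℕ} {p : Fin 28 × Fin 28} (hp : p ∈ markPairs) :
    (blockMark b i p.1).2.1 < (blockMark b i p.2).2.1 ∧
      combDist (blockMark b i p.1) (blockMark b i p.2) =
        pairSlope p * (b + 1) + 2 * i + pairOffset p := by
  obtain ⟨h₁, h₂, h₃, -, -⟩ := markPairs_spec p hp
  obtain ⟨x, hx⟩ := Nat.exists_eq_add_of_le h₁
  obtain ⟨y, hy⟩ := Nat.exists_eq_add_of_le h₂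
  have hlt : (blockMark b i p.1).2.1 < (blockMark b i p.2).2.1 := by
    simp only [blockMark, hx, hy]
    nlinarith
  refine ⟨hlt, ?_⟩
  rw [combDist, if_neg hlt.ne]
  simp only [blockMark, pairSlope, pairOffset, hx, hy] at hlt ⊢
  have e₁ : (markPos p.1 + x) * (b + 1) = markPos p.1 * (b + 1) + x * (b + 1) := by ring
  rw [e₁, Nat.add_sub_cancel_left, Nat.add_sub_cancel_left, add_mul, add_mul]
  omega

theorem pair_eq_of_combDist_eq {b i i' : ℕ} {p p' : Fin 28 × Fin 28} (hi : i < b) (hi' : i' < b)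
    (hp : p ∈ markPairs) (hp' : p' ∈ markPairs)
    (h : combDist (blockMark b i p.1) (blockMark b i p.2) =
      combDist (blockMark b i' p'.1) (blockMark b i' p'.2)) : i = i' ∧ p = p' := by
  rw [(combDist_blockMark hp).2, (combDist_blockMark hp').2] at h
  obtain ⟨-, -, -, hs, ho⟩ := markPairs_spec p hp
  obtain ⟨-, -, -, hs', ho'⟩ := markPairs_spec p' hp'
  obtain ⟨e, he⟩ := Nat.dvd_of_mod_eq_zero hs
  obtain ⟨e', he'⟩ := Nat.dvd_of_mod_eq_zero hs'
  have hee : e = e' := by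
    rw [he, he'] at h
    rcases lt_trichotomy e e' with hlt | heq | hlt
    · nlinarith
    · exact heq
    · nlinarith
  have hpp : p = p' := by
    refine List.inj_on_of_nodup_map nodup_pairSlots hp hp' ?_
    rw [he, he', hee] at h ⊢
    omega
  subst hpp
  exact ⟨by omega, rfl⟩

/-- The marks of all `b` blocks. -/
def blockMarks (b : ℕ) : Finset ((ℕ × ℕ) × ℕ × ℕ) :=
  (Finset.range b ×ˢ Finset.univ).image fun x => blockMark b x.1 x.2

theorem mem_blockMarks {b : ℕ} {a : (ℕ × ℕ) × ℕ × ℕ} :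
    a ∈ blockMarks b ↔ ∃ i < b, ∃ j, blockMark b i j = a := by
  simp [blockMarks]

theorem blockMark_inj_of_spine {b i i' : ℕ} {j j' : Fin 28}
    (hk : (blockMark b i j).1 = (blockMark b i' j').1)
    (hs : (blockMark b i j).2.1 = (blockMark b i' j').2.1) : i = i' ∧ j = j' := by
  obtain ⟨rfl, ht⟩ := Prod.mk.inj hk
  refine ⟨rfl, ?_⟩
  rcases lt_trichotomy j j' with h | h | h
  · exact absurd hs (combDist_blockMark (p := (j, j'))
      (mem_markPairs.2 ⟨h, ht⟩)).1.ne
  · exact h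
  · exact absurd hs (combDist_blockMark (p := (j', j))
      (mem_markPairs.2 ⟨h, ht.symm⟩)).1.ne'

theorem card_blockMarks (b : ℕ) : (blockMarks b).card = 28 * b := by
  rw [blockMarks, Finset.card_image_of_injOn]
  · simp [mul_comm]
  · rintro ⟨i, j⟩ - ⟨i', j'⟩ - he
    obtain ⟨rfl, rfl⟩ := blockMark_inj_of_spine (congrArg (·.1) he)
      (congrArg (·.2.1) he)
    rfl

theorem exists_pair_of_mem_blockMarks {b : ℕ} {a a' : (ℕ × ℕ) × ℕ × ℕ} (ha : a ∈ blockMarks b)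
    (ha' : a' ∈ blockMarks b) (hne : a ≠ a') (hk : a.1 = a'.1) :
    ∃ i < b, ∃ p ∈ markPairs, s(a, a') = s(blockMark b i p.1, blockMark b i p.2) ∧
      combDist a a' = combDist (blockMark b i p.1) (blockMark b i p.2) := by
  obtain ⟨i, hi, j, rfl⟩ := mem_blockMarks.1 ha
  obtain ⟨i', -, j', rfl⟩ := mem_blockMarks.1 ha'
  obtain ⟨rfl, ht⟩ := Prod.mk.inj hk
  rcases lt_trichotomy j j' with h | rfl | h
  · exact ⟨i, hi, (j, j'), mem_markPairs.2 ⟨h, ht⟩, rfl, rfl⟩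
  · exact absurd rfl hne
  · exact ⟨i, hi, (j', j), mem_markPairs.2 ⟨h, ht.symm⟩, Sym2.eq_swap, combDist_comm _ _⟩

theorem distinctCycleLengths_blockMarks (b : ℕ) :
    DistinctCycleLengths (hubComb (blockMarks b : Set ((ℕ × ℕ) × ℕ × ℕ))) := by
  refine distinctCycleLengths_hubComb ?_ ?_
  · intro a ha a' ha' hk hs
    obtain ⟨i, hi, j, rfl⟩ := mem_blockMarks.1 ha
    obtain ⟨i', -, j', rfl⟩ := mem_blockMarks.1 ha'
    obtain ⟨rfl, rfl⟩ := blockMark_inj_of_spine hk hs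
    rfl
  · intro a ha a' ha' c hc c' hc' hne hne' hk hk' h
    obtain ⟨i, hi, p, hp, he, hd⟩ := exists_pair_of_mem_blockMarks ha ha' hne hk
    obtain ⟨i', hi', p', hp', he', hd'⟩ := exists_pair_of_mem_blockMarks hc hc' hne' hk'
    obtain ⟨rfl, rfl⟩ := pair_eq_of_combDist_eq hi hi' hp hp' (hd ▸ hd' ▸ h)
    rw [he, he']

theorem le_ncard_edgeSet_hubComb {K : Type*} [DecidableEq K] {B M R : Finset (K × ℕ × ℕ)}
    (hMB : M ⊆ B) (hB : ∀ a ∈ B, combParent a ∈ B) (hR : ∀ a ∈ B, combParent a = a → a ∈ R)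
    {α : Type*} [Finite α] (f : α → Option (K × ℕ × ℕ)) (hnone : none ∈ Set.range f)
    (hf : ∀ a ∈ B, some a ∈ Set.range f) :
    B.card + M.card ≤ ((hubComb (M : Set (K × ℕ × ℕ))).comap f).edgeSet.ncard + R.card := by
  classical
  set S₁ := (B \ R).image fun a => s(some a, some (combParent a)) with hS₁
  set S₂ := M.image fun a => s(none, some a) with hS₂
  have h₁ : S₁.card = (B \ R).card := by
    refine Finset.card_image_of_injOn fun a ha a' ha' h => ?_
    have hr : ∀ a, a ∈ B \ R → combParent a ≠ a := by
      intro a ha h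
      rw [Finset.mem_sdiff] at ha
      exact ha.2 (hR a ha.1 h)
    obtain ⟨h, -⟩ | ⟨h, h'⟩ := Sym2.eq_iff.1 h
    · simpa using h
    · have e₁ := combParent_rank (hr a ha)
      have e₂ := combParent_rank (hr a' ha')
      rw [Option.some_inj] at h h'
      rw [h'] at e₁
      rw [← h] at e₂
      omega
  have h₂ : S₂.card = M.card := by
    refine Finset.card_image_of_injOn fun a _ a' _ h => ?_
    simpa using h
  have hdis : Disjoint S₁ S₂ := by
    rw [Finset.disjoint_left]
    intro e he he'
    obtain ⟨a, -, rfl⟩ := Finset.mem_image.1 he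
    obtain ⟨a', -, h⟩ := Finset.mem_image.1 he'
    simp at h
  have hsub : ((S₁ ∪ S₂ : Finset _) : Set (Sym2 (Option (K × ℕ × ℕ)))) ⊆
      Sym2.map f '' ((hubComb (M : Set (K × ℕ × ℕ))).comap f).edgeSet := by
    intro e he
    rw [Finset.mem_coe, Finset.mem_union] at he
    obtain he | he := he
    · obtain ⟨a, ha, rfl⟩ := Finset.mem_image.1 he
      rw [Finset.mem_sdiff] at ha
      obtain ⟨x, hx⟩ := hf a ha.1
      obtain ⟨y, hy⟩ := hf _ (hB a ha.1)
      refine ⟨s(x, y), ?_, by simp [hx, hy]⟩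
      rw [SimpleGraph.mem_edgeSet, SimpleGraph.comap_adj, hx, hy, hubComb_adj_some]
      exact ⟨fun h => ha.2 (hR a ha.1 h.symm), .inl rfl⟩
    · obtain ⟨a, ha, rfl⟩ := Finset.mem_image.1 he
      obtain ⟨x, hx⟩ := hnone
      obtain ⟨y, hy⟩ := hf a (hMB ha)
      refine ⟨s(x, y), ?_, by simp [hx, hy]⟩
      rw [SimpleGraph.mem_edgeSet, SimpleGraph.comap_adj, hx, hy, hubComb_adj_none]
      exact ha
  have h₃ := (Set.ncard_le_ncard hsub (Set.toFinite _)).trans (Set.ncard_image_le (Set.toFinite _))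
  rw [Set.ncard_coe_finset, Finset.card_union_of_disjoint hdis, h₁, h₂] at h₃
  have h₄ := Finset.le_card_sdiff R B
  omega

/-- The vertices of the trees of the `i`-th of `b` blocks. -/
def blockVertices (b i : ℕ) : Finset ((ℕ × ℕ) × ℕ × ℕ) :=
  (Finset.univ.biUnion fun j : Fin 28 =>
    (Finset.range (markHeight j * (b + 1) + i + markBump j + 1)).image fun h =>
      ((i, markTree j), markPos j * (b + 1) + markShift j, h)) ∪
  Finset.univ.biUnion fun k : Fin 11 =>
    (Finset.range (treeLength k * (b + 1) + 3)).image fun s => ((i, (k : ℕ)), s, 0)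

theorem mem_blockVertices {b i : ℕ} {a : (ℕ × ℕ) × ℕ × ℕ} :
    a ∈ blockVertices b i ↔
      (∃ j, ∃ h ≤ markHeight j * (b + 1) + i + markBump j,
        ((i, markTree j), markPos j * (b + 1) + markShift j, h) = a) ∨
      ∃ k : Fin 11, ∃ s ≤ treeLength k * (b + 1) + 2, ((i, (k : ℕ)), s, 0) = a := by
  simp [blockVertices, Nat.lt_succ_iff]

theorem card_blockVertices_le (b i : ℕ) :
    (blockVertices b i).card ≤ 28 * i + (106 * b + 173) := by
  have h₁ : ∑ j : Fin 28, (markHeight j * (b + 1) + i + markBump j + 1) =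
      (∑ j, markHeight j) * (b + 1) + 28 * i + ∑ j, markBump j + 28 := by
    simp [Finset.sum_add_distrib, Finset.sum_mul]
  have h₂ : ∑ k : Fin 11, (treeLength k * (b + 1) + 3) = (∑ k, treeLength k) * (b + 1) + 33 := by
    simp [Finset.sum_add_distrib, Finset.sum_mul]
  have h₃ : ∑ j, markHeight j = 34 := by decide +kernel
  have h₄ : ∑ j, markBump j = 6 := by decide +kernel
  have h₅ : ∑ k, treeLength k = 72 := by decide +kernel
  have h := (Finset.card_union_le _ _).trans (add_le_add
    (Finset.card_biUnion_le.trans (Finset.sum_le_sum fun j (_ : j ∈ Finset.univ) =>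
      (Finset.card_image_le (s := Finset.range (markHeight j * (b + 1) + i + markBump j + 1))
        (f := fun h => ((i, markTree j), markPos j * (b + 1) + markShift j, h)))))
    (Finset.card_biUnion_le.trans (Finset.sum_le_sum fun k (_ : k ∈ Finset.univ) =>
      (Finset.card_image_le (s := Finset.range (treeLength k * (b + 1) + 3))
        (f := fun s => ((i, (k : ℕ)), s, 0))))))
  simp only [Finset.card_range, h₁, h₂, h₃, h₄, h₅] at h
  exact h.trans (by omega)

theorem markTree_spec : ∀ j : Fin 28, ∃ k : Fin 11, (k : ℕ) = markTree j ∧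
    markPos j ≤ treeLength k ∧ markShift j ≤ 2 := by
  decide +kernel

theorem combParent_mem_blockVertices {b i : ℕ} {a : (ℕ × ℕ) × ℕ × ℕ}
    (ha : a ∈ blockVertices b i) : combParent a ∈ blockVertices b i := by
  rw [mem_blockVertices] at ha ⊢
  obtain ⟨j, h, hh, rfl⟩ | ⟨k, s, hs, rfl⟩ := ha
  · cases h with
    | succ h => exact .inl ⟨j, h, by omega, rfl⟩
    | zero =>
      obtain ⟨k, hk, hp, hd⟩ := markTree_spec j
      have hle := Nat.mul_le_mul_right (b + 1) hp
      generalize hq : markPos j * (b + 1) + markShift j = q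
      refine .inr ⟨k, q - 1, by omega, ?_⟩
      rw [hk]
      cases q <;> rfl
  · refine .inr ⟨k, s - 1, by omega, ?_⟩
    cases s <;> rfl

/-- The vertices of all `b` blocks, and a path with `m` vertices. -/
def combVertices (b m : ℕ) : Finset ((ℕ × ℕ) × ℕ × ℕ) :=
  (Finset.range b).biUnion (blockVertices b) ∪ (Finset.range m).image fun s => ((b, 0), s, 0)

/-- The roots of the trees which contain the vertices in `combVertices b m`. -/
def combRoots (b : ℕ) : Finset ((ℕ × ℕ) × ℕ × ℕ) :=
  insert ((b, 0), 0, 0)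
    ((Finset.range b ×ˢ (Finset.univ : Finset (Fin 11))).image fun x => ((x.1, (x.2 : ℕ)), 0, 0))

theorem mem_combVertices {b m : ℕ} {a : (ℕ × ℕ) × ℕ × ℕ} :
    a ∈ combVertices b m ↔ (∃ i < b, a ∈ blockVertices b i) ∨ ∃ s < m, ((b, 0), s, 0) = a := by
  simp [combVertices]

theorem card_combVertices_zero_le (b : ℕ) :
    (combVertices b 0).card ≤ 120 * b ^ 2 + 159 * b := by
  have h := (Finset.card_biUnion_le (s := Finset.range b) (t := blockVertices b)).trans
    (Finset.sum_le_sum fun i _ => card_blockVertices_le b i)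
  rw [Finset.sum_add_distrib, ← Finset.mul_sum, Finset.sum_const, Finset.card_range,
    smul_eq_mul] at h
  have h' := Finset.sum_range_id_mul_two b
  simp only [combVertices, Finset.range_zero, Finset.image_empty, Finset.union_empty]
  cases b with
  | zero => simp
  | succ b =>
    rw [Nat.add_sub_cancel] at h'
    nlinarith

theorem card_combVertices (b m : ℕ) :
    (combVertices b m).card = (combVertices b 0).card + m := by
  simp only [combVertices, Finset.range_zero, Finset.image_empty, Finset.union_empty]
  rw [Finset.card_union_of_disjoint, Finset.card_image_of_injective, Finset.card_range]
  · intro s s' h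
    simpa using h
  · rw [Finset.disjoint_left]
    intro a ha ha'
    obtain ⟨i, hi, ha⟩ := Finset.mem_biUnion.1 ha
    obtain ⟨s, -, rfl⟩ := Finset.mem_image.1 ha'
    rw [Finset.mem_range] at hi
    rw [mem_blockVertices] at ha
    obtain ⟨j, h, -, he⟩ | ⟨k, s, -, he⟩ := ha <;> simp at he <;> omega

theorem blockMarks_subset_combVertices (b m : ℕ) : blockMarks b ⊆ combVertices b m := by
  intro a ha
  obtain ⟨i, hi, j, rfl⟩ := mem_blockMarks.1 ha
  exact mem_combVertices.2 (.inl ⟨i, hi, mem_blockVertices.2 (.inl ⟨j, _, le_rfl, rfl⟩)⟩)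

theorem combParent_mem_combVertices {b m : ℕ} {a : (ℕ × ℕ) × ℕ × ℕ}
    (ha : a ∈ combVertices b m) : combParent a ∈ combVertices b m := by
  rw [mem_combVertices] at ha ⊢
  obtain ⟨i, hi, ha⟩ | ⟨s, hs, rfl⟩ := ha
  · exact .inl ⟨i, hi, combParent_mem_blockVertices ha⟩
  · refine .inr ⟨s - 1, by omega, ?_⟩
    cases s <;> rfl

theorem mem_combRoots_of_combParent_eq {b m : ℕ} {a : (ℕ × ℕ) × ℕ × ℕ}
    (ha : a ∈ combVertices b m) (h : combParent a = a) : a ∈ combRoots b := by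
  obtain ⟨⟨i, k⟩, _ | s, _ | t⟩ := a
  · rw [combRoots, Finset.mem_insert, Finset.mem_image]
    obtain ⟨i', hi, ha⟩ | ⟨s, -, ha⟩ := mem_combVertices.1 ha
    · right
      obtain ⟨j, h, -, he⟩ | ⟨k', s, -, he⟩ := mem_blockVertices.1 ha
      · obtain ⟨k', hk, -, -⟩ := markTree_spec j
        exact ⟨(i', k'), by simpa using hi, by simp_all⟩
      · exact ⟨(i', k'), by simpa using hi, by simp_all⟩
    · left
      simp_all
  all_goals simp [combParent] at h

theorem card_combRoots_le (b : ℕ) : (combRoots b).card ≤ 11 * b + 1 := by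
  refine (Finset.card_insert_le _ _).trans (Nat.succ_le_succ (Finset.card_image_le.trans ?_))
  simp [mul_comm]

theorem exists_distinctCycleLengths_of_le {b n : ℕ} (hn : 120 * b ^ 2 + 159 * b + 1 ≤ n) :
    ∃ G : SimpleGraph (Fin n), DistinctCycleLengths G ∧ n + 17 * b ≤ G.edgeSet.ncard + 2 := by
  obtain ⟨m, hm⟩ := Nat.exists_eq_add_of_le
    ((Nat.succ_le_succ (card_combVertices_zero_le b)).trans hn)
  have hcard : (Finset.insertNone (combVertices b m)).card = n := by
    rw [Finset.card_insertNone, card_combVertices]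
    omega
  let f : Fin n → Option ((ℕ × ℕ) × ℕ × ℕ) :=
    fun x => ((Finset.insertNone (combVertices b m)).equivFinOfCardEq hcard).symm x
  have hinj : Function.Injective f := Subtype.val_injective.comp (Equiv.injective _)
  have hran : ∀ v ∈ Finset.insertNone (combVertices b m), v ∈ Set.range f := fun v hv =>
    ⟨(Finset.insertNone (combVertices b m)).equivFinOfCardEq hcard ⟨v, hv⟩, by simp [f]⟩
  refine ⟨(hubComb (blockMarks b)).comap f,
    (distinctCycleLengths_blockMarks b).of_injective_hom ⟨f, id⟩ hinj, ?_⟩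
  have h := le_ncard_edgeSet_hubComb (blockMarks_subset_combVertices b m)
    (fun _ => combParent_mem_combVertices) (fun _ => mem_combRoots_of_combParent_eq) f
    (hran _ (by simp)) (fun a ha => hran _ (by simpa using ha))
  rw [Finset.card_insertNone] at hcard
  rw [card_blockMarks] at h
  have := card_combRoots_le b
  omega

theorem exists_distinctCycleLengths_ncard_eq {n e : ℕ} {G : SimpleGraph (Fin n)}
    (hG : DistinctCycleLengths G) (he : e ≤ G.edgeSet.ncard) :
    ∃ G' : SimpleGraph (Fin n), DistinctCycleLengths G' ∧ G'.edgeSet.ncard = e := by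
  obtain ⟨S, hS, rfl⟩ := Set.exists_subset_card_eq he
  have hS' : (SimpleGraph.fromEdgeSet S).edgeSet = S := by
    rw [SimpleGraph.edgeSet_fromEdgeSet, sdiff_eq_left, Set.disjoint_left]
    exact fun e he => G.not_isDiag_of_mem_edgeSet (hS he)
  have hle : SimpleGraph.fromEdgeSet S ≤ G := by
    rw [← SimpleGraph.edgeSet_subset_edgeSet, hS']
    exact hS
  exact ⟨SimpleGraph.fromEdgeSet S,
    hG.of_injective_hom (SimpleGraph.Hom.ofLE hle) Function.injective_id, by rw [hS']⟩

theorem stmt1 (r t n : ℕ) (hr : 1 ≤ r) (ht : t = 1260 * r + 169)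
    (hn : (540 * (t : ℚ) ^ 2 + 175811 / 2 * t + 7989 / 2 : ℚ) ≤ (n : ℚ)) :
    ∃ G : SimpleGraph (Fin n), DistinctCycleLengths G ∧ G.edgeSet.ncard = n + 36 * t := by
  obtain ⟨b, hb₁, hb₂⟩ : ∃ b, 36 * t + 2 ≤ 17 * b ∧ 17 * b ≤ 36 * t + 18 :=
    ⟨(36 * t + 18) / 17, by omega, by omega⟩
  have hn' : 120 * b ^ 2 + 159 * b + 1 ≤ n := by
    have hb : (17 * b : ℚ) ≤ 36 * t + 18 := by exact_mod_cast hb₂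
    have hsq : (17 * b : ℚ) ^ 2 ≤ (36 * t + 18) ^ 2 := by gcongr
    have ht₀ : (0 : ℚ) ≤ t := by positivity
    have : (120 * b ^ 2 + 159 * b + 1 : ℚ) ≤ n := by nlinarith
    exact_mod_cast this
  obtain ⟨G, hG, he⟩ := exists_distinctCycleLengths_of_le hn'
  exact exists_distinctCycleLengths_ncard_eq hG (by omega)
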